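/- arXiv:2511.21917 — 4 statements merged into one kernel-verified Lean document; each statement's English description precedes it below -/
import Mathlib

section
/- Let M > 1, n ≥ 1 a natural number, and v ≥ 0 with (n−1)·M·v ≤ (M−1)·n. Let α* ∈ [1/M, 1) satisfy the cubic h(α*) = 0 and let β* ∈ (α*/M, (M+1)/(2M)) satisfy q(β*) = 0, where h and q are as in the context. Define r(β) = (2Mnα* + Mvα* − (n−1)vα* − Mnvα*) + 2M(n + n(v−1)α* − vα*)β + Mn(α* − 1 − M(1+α*))β². Then r(β*) ≤ 0. -/
/-- The cubic `h(α)` from the two-step stochastic stepsize schedule analysis. -/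
noncomputable def hcub (M n v α : ℝ) : ℝ :=
  (M - 1) * M * n * α ^ 3 - (M + 1) * (M - 2) * n * α ^ 2
    - (4 * n + (M - 1) * (n - 1) * v) * α + 2 * n

/-- The quadratic `q(β)` (in `β`, with parameters `M, n, v, α`) from the
two-step stochastic stepsize schedule analysis. -/
noncomputable def qquad (M n v α β : ℝ) : ℝ :=
  M * n * ((M - 1) ^ 2 * n + (M + 1) ^ 2 * (n - 1) * v) * ((M - 1) * α + (M + 1)) * β ^ 2
  + 2 * M * (2 * (M - 1) * M * n * ((n - 1) * v - n) * α ^ 2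
      + (M + 1) * ((n - 1) * v - n) * ((3 - M) * n + (M - 1) * (n - 1) * v) * α
      + n * (n - (M - 4) * M * n - (M + 1) * (M + 3) * (n - 1) * v)) * β
  + (-2 * M * (M ^ 2 - 1) * n * ((n - 1) * v - n) * α ^ 2
      + (2 * (2 + M + 2 * M ^ 2 - M ^ 3) * n ^ 2 + (M - 3) * (M + 1) ^ 2 * (n - 1) * n * v
          - (M - 1) * (M + 1) ^ 2 * (n - 1) ^ 2 * v ^ 2) * α
      + 2 * (M + 1) ^ 2 * n * ((n - 1) * v - n))

/-- The auxiliary quadratic `r(β)` (in `β`, with parameters `M, n, v` and the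
first stepsize `α`). -/
noncomputable def rquad (M n v α β : ℝ) : ℝ :=
  (2 * M * n * α + M * v * α - (n - 1) * v * α - M * n * v * α)
    + 2 * M * (n + n * (v - 1) * α - v * α) * β
    + M * n * (α - 1 - M * (1 + α)) * β ^ 2

theorem stmt_10 (M : ℝ) (n : ℕ) (v : ℝ)
    (hM : 1 < M) (hn : 1 ≤ n) (hv : 0 ≤ v)
    (hbound : ((n : ℝ) - 1) * M * v ≤ (M - 1) * n)
    (α β : ℝ)
    (hα : α ∈ Set.Ico (1 / M) 1) (hroot : hcub M (n : ℝ) v α = 0)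
    (hβ : β ∈ Set.Ioo (α / M) ((M + 1) / (2 * M))) (hqroot : qquad M (n : ℝ) v α β = 0) :
    rquad M (n : ℝ) v α β ≤ 0 := by
  obtain ⟨hα1, hα2⟩ := hα
  obtain ⟨hβ1, hβ2⟩ := hβ
  have hN : (1 : ℝ) ≤ (n : ℝ) := by exact_mod_cast hn
  generalize (n : ℝ) = N at *
  have hN0 : 0 < N := by linarith
  have hM0 : 0 < M := by linarith
  obtain ⟨w, hw⟩ : ∃ w, (N - 1) * v = N * w := ⟨(N - 1) * v / N, by field_simp⟩
  have hw0 : 0 ≤ w := by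
    have h1 : 0 ≤ N * w := by rw [← hw]; exact mul_nonneg (by linarith) hv
    exact nonneg_of_mul_nonneg_right h1 hN0
  have hw1 : w < 1 := by
    have h1 : N * (M * w) ≤ N * (M - 1) := by
      have : N * (M * w) = (N - 1) * M * v := by linear_combination -M * hw
      linarith
    have h2 : M * w ≤ M - 1 := le_of_mul_le_mul_left h1 hN0
    by_contra h3
    push Not at h3
    nlinarith
  have hα0 : 1 ≤ M * α := by
    rw [div_le_iff₀ hM0] at hα1; linarith
  have hαp : 0 < α := by
    by_contra h; push Not at h; nlinarith
  have hβ3 : 2 * M * β - (M + 1) < 0 := by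
    rw [lt_div_iff₀ (by linarith)] at hβ2; linarith
  -- the cubic, normalised
  have hh : (M - 1) * w * α = (1 - α) * (2 - 2 * α - M * (M - 1) * α ^ 2) := by
    unfold hcub at hroot
    apply mul_left_cancel₀ hN0.ne'
    linear_combination -hroot - (M - 1) * α * hw
  have hk : 0 ≤ 2 - 2 * α - M * (M - 1) * α ^ 2 := by
    have h1 : 0 ≤ (1 - α) * (2 - 2 * α - M * (M - 1) * α ^ 2) := by
      rw [← hh]
      exact mul_nonneg (mul_nonneg (by linarith) hw0) hαp.le
    exact nonneg_of_mul_nonneg_right h1 (by linarith)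
  have hA : 0 ≤ (M + 1) - 2 * α - M * (M + 1) * w * α - M * (M - 1) * α ^ 2 := by
    have hid : (M - 1) * ((M + 1) - 2 * α - M * (M + 1) * w * α - M * (M - 1) * α ^ 2)
        = (M * α - 1) * ((M + 1) * (2 - 2 * α - M * (M - 1) * α ^ 2)
            + (M * (M - 1) ^ 2 * α + (M - 1) * (M + 1))) := by
      linear_combination -M * (M + 1) * hh
    have h1 : 0 ≤ M * (M - 1) ^ 2 * α := by positivity
    have h2 : 0 ≤ (M - 1) * (M + 1) := mul_nonneg (by linarith) (by linarith)
    have h3 : 0 ≤ (M + 1) * (2 - 2 * α - M * (M - 1) * α ^ 2) := mul_nonneg (by linarith) hk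
    have h4 := mul_nonneg (show 0 ≤ M * α - 1 by linarith) (add_nonneg h3 (add_nonneg h1 h2))
    rw [← hid] at h4
    exact nonneg_of_mul_nonneg_right h4 (by linarith)
  have hr : rquad M N v α β = N * ((2 * M - w - M * w) * α + 2 * M * (1 - α + w * α) * β
      - M * (M + 1 + (M - 1) * α) * β ^ 2) := by
    unfold rquad
    linear_combination (-(M + 1) * α + 2 * M * α * β) * hw
  have hmain : N * (((M - 1) ^ 2 + (M + 1) ^ 2 * w) * rquad M N v α β)
      = N ^ 2 * (2 * (1 - w)
        * ((M + 1) - 2 * α - M * (M + 1) * w * α - M * (M - 1) * α ^ 2)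
        * (2 * M * β - (M + 1))) := by
    rw [hr]
    have hv' : v * (N - 1) = N * w := by linarith
    have hq : qquad M N v α β = N ^ 2 * (
        M * ((M - 1) ^ 2 + (M + 1) ^ 2 * w) * ((M - 1) * α + (M + 1)) * β ^ 2
        + 2 * M * (2 * (M - 1) * M * (w - 1) * α ^ 2
          + (M + 1) * (w - 1) * ((3 - M) + (M - 1) * w) * α
          + (1 - (M - 4) * M - (M + 1) * (M + 3) * w)) * β
        + (-2 * M * (M ^ 2 - 1) * (w - 1) * α ^ 2
          + (2 * (2 + M + 2 * M ^ 2 - M ^ 3) + (M - 3) * (M + 1) ^ 2 * w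
            - (M - 1) * (M + 1) ^ 2 * w ^ 2) * α
          + 2 * (M + 1) ^ 2 * (w - 1))) := by
      have e1 : (M + 1) ^ 2 * (N - 1) * v = (M + 1) ^ 2 * (N * w) := by rw [← hw]; ring
      have e2 : (M - 1) * (N - 1) * v = (M - 1) * (N * w) := by rw [← hw]; ring
      have e3 : (M + 1) * (M + 3) * (N - 1) * v = (M + 1) * (M + 3) * (N * w) := by
        rw [← hw]; ring
      have e4 : (M - 3) * (M + 1) ^ 2 * (N - 1) * N * v
          = (M - 3) * (M + 1) ^ 2 * N * (N * w) := by rw [← hw]; ring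
      have e5 : (M - 1) * (M + 1) ^ 2 * (N - 1) ^ 2 * v ^ 2
          = (M - 1) * (M + 1) ^ 2 * (N * w) ^ 2 := by rw [← hw]; ring
      unfold qquad
      rw [e1, e2, e3, e4, e5, hw]
      ring
    rw [hq] at hqroot
    linear_combination -hqroot
  have hlam : 0 < (M - 1) ^ 2 + (M + 1) ^ 2 * w := by
    have : 0 < (M - 1) ^ 2 := pow_pos (by linarith) 2
    positivity
  have hneg : N * (((M - 1) ^ 2 + (M + 1) ^ 2 * w) * rquad M N v α β) ≤ 0 := by
    rw [hmain]
    apply mul_nonpos_of_nonneg_of_nonpos (by positivity)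
    exact mul_nonpos_of_nonneg_of_nonpos (mul_nonneg (by linarith) hA) hβ3.le
  by_contra hc
  push Not at hc
  have := mul_pos hN0 (mul_pos hlam hc)
  linarith
end

section
/- Let M > 1, n ≥ 1 a natural number, and v ≥ 0 with (n−1)·M·v ≤ (M−1)·n and (n−1)·v < n. Let α ∈ [1/M, 1) satisfy the cubic h(α) = 0 and β ∈ (α/M, (M+1)/(2M)) satisfy q(β) = 0 (h and q as in the context). Define λ₁ = (α + β − αβ)/(n(1+M+(M−1)α)), λ₂ = (Mβ + α(Mβ−1))/(Mn(1+M+(M−1)α)), λ₃ = n(λ₁ − λ₂), λ₄ = (n²(λ₁+Mλ₂)² − n(λ₁+λ₂))/(2(n−(n−1)v)) + (λ₁−λ₂)/2, λ₅ = (n²(λ₁+Mλ₂)² − n(λ₁+λ₂))/(2(n−(n−1)v)) − (λ₁−λ₂)/2, and τ = 1 − M(λ₃ + nλ₁ + nλ₂). Then λ₁ > 0, λ₂ > 0, λ₃ = α(1+M−2Mβ)/(M(1+M+(M−1)α)) > 0, λ₅ ≥ 0, λ₄ > 0, and τ = (1−α)(1+M−2Mβ)/(1+M+(M−1)α) > 0.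 -/
/-- The dual multiplier `λ₁ = λ_{i,*}`. -/
noncomputable def lam1 (M n α β : ℝ) : ℝ :=
  (α + β - α * β) / (n * (1 + M + (M - 1) * α))

/-- The dual multiplier `λ₂ = λ_{*,i}`. -/
noncomputable def lam2 (M n α β : ℝ) : ℝ :=
  (M * β + α * (M * β - 1)) / (M * n * (1 + M + (M - 1) * α))

/-- The dual multiplier `λ₃ = λ_{*,0}`. -/
noncomputable def lam3 (M n α β : ℝ) : ℝ :=
  n * (lam1 M n α β - lam2 M n α β)

/-- The dual multiplier `λ₄ = λ_{0,i}`. -/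
noncomputable def lam4 (M n v α β : ℝ) : ℝ :=
  (n ^ 2 * (lam1 M n α β + M * lam2 M n α β) ^ 2 - n * (lam1 M n α β + lam2 M n α β))
      / (2 * (n - (n - 1) * v))
    + (lam1 M n α β - lam2 M n α β) / 2

/-- The dual multiplier `λ₅ = λ_{i,0}`. -/
noncomputable def lam5 (M n v α β : ℝ) : ℝ :=
  (n ^ 2 * (lam1 M n α β + M * lam2 M n α β) ^ 2 - n * (lam1 M n α β + lam2 M n α β))
      / (2 * (n - (n - 1) * v))
    - (lam1 M n α β - lam2 M n α β) / 2

/-- The dual multiplier `τ`. -/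
noncomputable def tauD (M n α β : ℝ) : ℝ :=
  1 - M * (lam3 M n α β + n * lam1 M n α β + n * lam2 M n α β)

/-- The core inequality, in terms of the normalized variable `w = (n-1)v/n`. -/
lemma core_ineq (M w α β : ℝ) (hM : 1 < M) (hw : 0 ≤ w) (hw1 : w < 1)
    (hα0 : 1 ≤ M * α) (hα1 : α < 1) (hβ : 2 * M * β < M + 1)
    (hh : (M - 1) * M * α ^ 3 - (M + 1) * (M - 2) * α ^ 2 - (4 + (M - 1) * w) * α + 2 = 0)
    (hq : M * ((M - 1) ^ 2 + (M + 1) ^ 2 * w) * ((M - 1) * α + (M + 1)) * β ^ 2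
      + 2 * M * (2 * (M - 1) * M * (w - 1) * α ^ 2
        + (M + 1) * (w - 1) * ((3 - M) + (M - 1) * w) * α
        + (1 - (M - 4) * M - (M + 1) * (M + 3) * w)) * β
      + (-2 * M * (M ^ 2 - 1) * (w - 1) * α ^ 2
        + (2 * (2 + M + 2 * M ^ 2 - M ^ 3) + (M - 3) * (M + 1) ^ 2 * w
          - (M - 1) * (M + 1) ^ 2 * w ^ 2) * α
        + 2 * (M + 1) ^ 2 * (w - 1)) = 0) :
    0 ≤ M * ((1 + M + (M - 1) * α) * β ^ 2) - M * (2 * (1 - α + w * α) * β) - 2 * M * α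
      + w * α * (M + 1) := by
  have hM0 : 0 < M - 1 := by linarith
  have hα : 0 < α := by
    by_contra h
    nlinarith
  have hT : (M - 1) * M * α ^ 2 + 2 * α - 2 ≤ 0 := by
    have h1 : (1 - α) * ((M - 1) * M * α ^ 2 + 2 * α - 2) = -((M - 1) * w * α) := by
      linear_combination -hh
    have h2 : 0 ≤ (M - 1) * w * α := by positivity
    by_contra h
    have := mul_pos (sub_pos.2 hα1) (not_le.1 h)
    linarith
  have hR : 0 ≤ -(M + 1) * ((M - 1) * M * α ^ 2 + 2 * α - 2) + M * (M - 1) ^ 2 * α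
      + (M - 1) * (M + 1) := by
    have h1 : 0 ≤ (M + 1) * -((M - 1) * M * α ^ 2 + 2 * α - 2) :=
      mul_nonneg (by linarith) (by linarith)
    have h2 : 0 ≤ M * (M - 1) ^ 2 * α := by positivity
    have h3 : 0 ≤ (M - 1) * (M + 1) := mul_nonneg hM0.le (by linarith)
    linarith
  have hG : 0 ≤ (M + 1) - α * (2 + w * M * (M + 1)) - (M - 1) * M * α ^ 2 := by
    have h1 : (M - 1) * ((M + 1) - α * (2 + w * M * (M + 1)) - (M - 1) * M * α ^ 2)
      = (M * α - 1) * (-(M + 1) * ((M - 1) * M * α ^ 2 + 2 * α - 2) + M * (M - 1) ^ 2 * α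
      + (M - 1) * (M + 1)) := by
      linear_combination M * (M + 1) * hh
    have h2 := mul_nonneg (sub_nonneg.2 hα0) hR
    rw [← h1] at h2
    exact nonneg_of_mul_nonneg_right h2 hM0
  have hA : 0 < (M - 1) ^ 2 + (M + 1) ^ 2 * w := by positivity
  have hK : 0 ≤ 2 * (1 - w) * ((M + 1) - α * (2 + w * M * (M + 1)) - (M - 1) * M * α ^ 2)
      * (M + 1 - 2 * M * β) :=
    mul_nonneg (mul_nonneg (by linarith) hG) (by linarith)
  refine nonneg_of_mul_nonneg_right (a := (M - 1) ^ 2 + (M + 1) ^ 2 * w) ?_ hA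
  refine hK.trans_eq ?_
  linear_combination -hq

theorem stmt_14 (M : ℝ) (n : ℕ) (v : ℝ)
    (hM : 1 < M) (hn : 1 ≤ n) (hv : 0 ≤ v)
    (hbound : ((n : ℝ) - 1) * M * v ≤ (M - 1) * n)
    (hvn : ((n : ℝ) - 1) * v < n)
    (α β : ℝ)
    (hα : α ∈ Set.Ico (1 / M) 1) (hroot : hcub M (n : ℝ) v α = 0)
    (hβ : β ∈ Set.Ioo (α / M) ((M + 1) / (2 * M))) (hqroot : qquad M (n : ℝ) v α β = 0) :
    0 < lam1 M (n : ℝ) α β ∧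
    0 < lam2 M (n : ℝ) α β ∧
    (lam3 M (n : ℝ) α β
        = α * (1 + M - 2 * M * β) / (M * (1 + M + (M - 1) * α)) ∧
      0 < lam3 M (n : ℝ) α β) ∧
    0 ≤ lam5 M (n : ℝ) v α β ∧
    0 < lam4 M (n : ℝ) v α β ∧
    (tauD M (n : ℝ) α β
        = (1 - α) * (1 + M - 2 * M * β) / (1 + M + (M - 1) * α) ∧
      0 < tauD M (n : ℝ) α β) := by
  obtain ⟨hα0, hα1⟩ := hα
  obtain ⟨hβ0, hβ1⟩ := hβ
  have hN1 : (1 : ℝ) ≤ n := by exact_mod_cast hn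
  generalize (n : ℝ) = N at *
  have hN : 0 < N := by linarith
  have hM0 : 0 < M := by linarith
  have hMα : 1 ≤ M * α := by
    rw [div_le_iff₀ hM0] at hα0
    linarith
  have hα : 0 < α := lt_of_lt_of_le (by positivity) hα0
  have hMβ : α < M * β := by
    rw [div_lt_iff₀ hM0] at hβ0
    linarith
  have hβu : 2 * M * β < M + 1 := by
    rw [lt_div_iff₀ (by positivity)] at hβ1
    linarith
  have hβ : 0 < β := lt_trans (by positivity) hβ0
  have hD : 0 < 1 + M + (M - 1) * α := by
    have : 0 < (M - 1) * α := mul_pos (by linarith) hα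
    linarith
  obtain ⟨w, hw⟩ : ∃ w, (N - 1) * v = N * w := ⟨(N - 1) * v / N, by field_simp⟩
  have hw0 : 0 ≤ w := by
    have : 0 ≤ N * w := hw ▸ mul_nonneg (by linarith) hv
    exact nonneg_of_mul_nonneg_right this hN
  have hw1 : w < 1 := by
    by_contra h
    nlinarith
  have hcore := core_ineq M w α β hM hw0 hw1 hMα hα1 hβu
    (by
      have h1 : N * ((M - 1) * M * α ^ 3 - (M + 1) * (M - 2) * α ^ 2
        - (4 + (M - 1) * w) * α + 2) = 0 := by
        unfold hcub at hroot
        linear_combination hroot + (M - 1) * α * hw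
      exact (mul_eq_zero.1 h1).resolve_left hN.ne')
    (by
      refine (mul_eq_zero.1 (?_ : N ^ 2 * _ = 0)).resolve_left (pow_pos hN 2).ne'
      have e : qquad M N v α β =
        M * N * ((M - 1) ^ 2 * N + (M + 1) ^ 2 * (N * w)) * ((M - 1) * α + (M + 1)) * β ^ 2
        + 2 * M * (2 * (M - 1) * M * N * ((N * w) - N) * α ^ 2
            + (M + 1) * ((N * w) - N) * ((3 - M) * N + (M - 1) * (N * w)) * α
            + N * (N - (M - 4) * M * N - (M + 1) * (M + 3) * (N * w))) * β
        + (-2 * M * (M ^ 2 - 1) * N * ((N * w) - N) * α ^ 2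
            + (2 * (2 + M + 2 * M ^ 2 - M ^ 3) * N ^ 2 + (M - 3) * (M + 1) ^ 2 * (N * w) * N
                - (M - 1) * (M + 1) ^ 2 * (N * w) ^ 2) * α
            + 2 * (M + 1) ^ 2 * N * ((N * w) - N)) := by
        unfold qquad
        rw [← hw]
        ring
      rw [e] at hqroot
      linear_combination hqroot)
  have h1 : 0 < lam1 M N α β := by
    unfold lam1
    have : 0 < β * (1 - α) := mul_pos hβ (by linarith)
    exact div_pos (by linarith) (by positivity)
  have h2 : 0 < lam2 M N α β := by
    unfold lam2
    have : 0 < α * (M * β) := by positivity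
    exact div_pos (by linarith) (by positivity)
  obtain ⟨D, hDdef⟩ : ∃ D, 1 + M + (M - 1) * α = D := ⟨_, rfl⟩
  have hD' : D ≠ 0 := by
    rw [← hDdef]
    exact hD.ne'
  have h3 : lam3 M N α β = α * (1 + M - 2 * M * β) / (M * (1 + M + (M - 1) * α)) := by
    unfold lam3 lam1 lam2
    rw [hDdef]
    field_simp
    ring
  have h3' : 0 < lam3 M N α β := by
    rw [h3]
    exact div_pos (mul_pos hα (by linarith)) (by positivity)
  have h12 : 0 < lam1 M N α β - lam2 M N α β := pos_of_mul_pos_right h3' hN.le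
  have hsum : N * (lam1 M N α β + M * lam2 M N α β) = β := by
    unfold lam1 lam2
    rw [hDdef]
    field_simp
    rw [← hDdef]
    ring
  have h5 : 0 ≤ lam5 M N v α β := by
    have e : lam5 M N v α β = (M * ((1 + M + (M - 1) * α) * β ^ 2)
        - M * (2 * (1 - α + w * α) * β) - 2 * M * α + w * α * (M + 1))
        / (2 * M * N * (1 - w) * (1 + M + (M - 1) * α)) := by
      unfold lam5
      rw [← mul_pow, hsum, hw]
      unfold lam1 lam2
      have hw' : 1 - w ≠ 0 := by linarith
      have hw2 : N - N * w = N * (1 - w) := by ring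
      rw [hw2]
      rw [hDdef]
      field_simp
      rw [← hDdef]
      ring
    rw [e]
    have : 0 < 1 - w := by linarith
    exact div_nonneg hcore (by positivity)
  have h4 : 0 < lam4 M N v α β := by
    have e : lam4 M N v α β = lam5 M N v α β + (lam1 M N α β - lam2 M N α β) := by
      unfold lam4 lam5
      ring
    rw [e]
    linarith
  have h6 : tauD M N α β = (1 - α) * (1 + M - 2 * M * β) / (1 + M + (M - 1) * α) := by
    unfold tauD
    rw [h3]
    unfold lam1 lam2
    rw [hDdef]
    field_simp
    rw [← hDdef]
    ring
  refine ⟨h1, h2, ⟨h3, h3'⟩, h5, h4, h6, ?_⟩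
  rw [h6]
  exact div_pos (mul_pos (by linarith) (by linarith)) hD
end

section
/- Let d ∈ ℕ, let M > 1, R > 0, σ > 0, let n ≥ 2 be a natural number, and let v satisfy 0 < v ≤ (M−1)n/((n−1)M). Let α ∈ [1/M, 1) satisfy the cubic h(α) = 0 and β ∈ (α/M, (M+1)/(2M)) satisfy q(β) = 0 (h and q as in the context). Let f : ℝᵈ → ℝ be differentiable, 1-strongly convex, with M-Lipschitz gradient, and let x* be its (unique) global minimizer. Let x₀ ∈ ℝᵈ with ‖x₀ − x*‖ ≤ R; let g₀⁽¹⁾,…,g₀⁽ⁿ⁾ ∈ ℝᵈ satisfy (1/n)∑ᵢ g₀⁽ⁱ⁾ = ∇f(x₀) and (1/n)∑ᵢ ‖g₀⁽ⁱ⁾ − ∇f(x₀)‖² ≤ σ²; set x₁⁽ⁱ⁾ = x₀ − α g₀⁽ⁱ⁾ for each i; for each i let g₁⁽ⁱ'¹⁾,…,g₁⁽ⁱ'ⁿ⁾ ∈ ℝᵈ satisfy (1/n)∑ⱼ g₁⁽ⁱ'ʲ⁾ = ∇f(x₁⁽ⁱ⁾) and (1/n)∑ⱼ ‖g₁⁽ⁱ'ʲ⁾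 − ∇f(x₁⁽ⁱ⁾)‖² ≤ σ²; and set x₂⁽ⁱ'ʲ⁾ = x₁⁽ⁱ⁾ − β g₁⁽ⁱ'ʲ⁾. Then (1/n²)∑ᵢ∑ⱼ ‖x₂⁽ⁱ'ʲ⁾ − x*‖² ≤ τR² + (μ₀ + nμ₁)σ², where, with λ₁, λ₂, λ₃, λ₄, λ₅ as in the context, τ = 1 − M(λ₃ + nλ₁ + nλ₂), μ₀ = max{0, ((n² − (n−1)²v²)/((n−1)v))(λ₄+λ₅) + n(λ₄+λ₅) − 2αn(λ₄ + Mλ₅) + λ₃}, and μ₁ = max{0, (1 − (n−1)v/n)(λ₄+λ₅) + λ₂ + λ₁}. -/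
/-- The dual multiplier `μ₀`. -/
noncomputable def mu0 (M n v α β : ℝ) : ℝ :=
  max 0
    ((n ^ 2 - (n - 1) ^ 2 * v ^ 2) / ((n - 1) * v)
        * (lam4 M n v α β + lam5 M n v α β)
      + n * (lam4 M n v α β + lam5 M n v α β)
      - 2 * α * n * (lam4 M n v α β + M * lam5 M n v α β)
      + lam3 M n α β)

/-- The dual multiplier `μ₁ = ⋯ = μₙ`. -/
noncomputable def mu1 (M n v α β : ℝ) : ℝ :=
  max 0
    ((1 - (n - 1) * v / n) * (lam4 M n v α β + lam5 M n v α β)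
      + lam2 M n α β + lam1 M n α β)

open scoped RealInnerProductSpace



/-- Descent lemma. -/
lemma descent_aux {d : ℕ} {M : ℝ} {f : EuclideanSpace ℝ (Fin d) → ℝ}
    {g : EuclideanSpace ℝ (Fin d) → EuclideanSpace ℝ (Fin d)}
    (hgrad : ∀ x, HasGradientAt f (g x) x)
    (hlip : ∀ x y, ‖g x - g y‖ ≤ M * ‖x - y‖) (x p : EuclideanSpace ℝ (Fin d)) :
    f (x + p) ≤ f x + ⟪g x, p⟫ + M / 2 * ‖p‖ ^ 2 := by
  have hφ : ∀ t : ℝ, HasDerivAt (fun t : ℝ => f (x + t • p)) ⟪g (x + t • p), p⟫ t := by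
    intro t
    have h1 : HasDerivAt (fun t : ℝ => x + t • p) p t := by
      simpa using ((hasDerivAt_id t).smul_const p).const_add x
    have h2 := (hgrad (x + t • p)).hasFDerivAt.comp_hasDerivAt t h1
    simpa [Function.comp_def] using h2
  have hψ : ∀ t : ℝ, HasDerivAt
      (fun t : ℝ => t * ⟪g x, p⟫ + M / 2 * ‖p‖ ^ 2 * t ^ 2 - f (x + t • p))
      (⟪g x, p⟫ + M * ‖p‖ ^ 2 * t - ⟪g (x + t • p), p⟫) t := by
    intro t
    have h1 := ((hasDerivAt_id t).mul_const ⟪g x, p⟫).add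
      (((hasDerivAt_id t).pow 2).const_mul (M / 2 * ‖p‖ ^ 2))
    have h2 := h1.sub (hφ t)
    refine h2.congr_deriv ?_
    simp
    ring
  have hmono : MonotoneOn
      (fun t : ℝ => t * ⟪g x, p⟫ + M / 2 * ‖p‖ ^ 2 * t ^ 2 - f (x + t • p)) (Set.Ici 0) := by
    apply monotoneOn_of_deriv_nonneg (convex_Ici 0)
    · exact fun t _ => (hψ t).continuousAt.continuousWithinAt
    · exact fun t _ => (hψ t).differentiableAt.differentiableWithinAt
    · intro t ht
      rw [interior_Ici] at ht
      have ht0 : 0 < t := ht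
      rw [(hψ t).deriv]
      have h1 : ⟪g (x + t • p) - g x, p⟫ ≤ ‖g (x + t • p) - g x‖ * ‖p‖ :=
        real_inner_le_norm _ _
      have h2 := hlip (x + t • p) x
      rw [add_sub_cancel_left, norm_smul, Real.norm_of_nonneg ht0.le] at h2
      have h3 := mul_le_mul_of_nonneg_right h2 (norm_nonneg p)
      rw [inner_sub_left] at h1
      nlinarith
  have := hmono (Set.mem_Ici.2 le_rfl) (Set.mem_Ici.2 zero_le_one) zero_le_one
  simp at this
  linarith

/-- Interpolation inequality for smooth strongly convex functions. -/
lemma interp_aux {d : ℕ} {M : ℝ} (hM : 1 < M) {f : EuclideanSpace ℝ (Fin d) → ℝ}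
    {g : EuclideanSpace ℝ (Fin d) → EuclideanSpace ℝ (Fin d)}
    (hgrad : ∀ x, HasGradientAt f (g x) x)
    (hstrong : ∀ x y, f y ≥ f x + ⟪g x, y - x⟫ + 1 / 2 * ‖y - x‖ ^ 2)
    (hlip : ∀ x y, ‖g x - g y‖ ≤ M * ‖x - y‖) (a b r s c : EuclideanSpace ℝ (Fin d))
    (hr : g a = r) (hs : g b = s) (hc : a - b = c) :
    0 ≤ 2 * (M - 1) * (f a - f b - ⟪s, c⟫)
      - ‖r - s‖ ^ 2 - M * ‖c‖ ^ 2 + 2 * ⟪r - s, c⟫ := by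
  have hM' : 0 < M - 1 := by linarith
  subst hr hs
  have ha : a = b + c := by rw [← hc]; abel
  set p : EuclideanSpace ℝ (Fin d) := (M - 1)⁻¹ • (c - (g a - g b)) with hp
  have h1 := descent_aux hgrad hlip a p
  have h2 := hstrong b (a + p)
  have h3 : a + p - b = c + p := by rw [ha]; abel
  rw [h3] at h2
  have hpc : (M - 1) • p = c - (g a - g b) := by
    rw [hp, smul_smul, mul_inv_cancel₀ hM'.ne', one_smul]
  have e1 : (M - 1) * ⟪p, p⟫ = ⟪c, p⟫ - (⟪g a, p⟫ - ⟪g b, p⟫) := by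
    rw [← real_inner_smul_left, hpc, inner_sub_left, inner_sub_left]
  have e2 : (M - 1) * ((M - 1) * ⟪p, p⟫) = ‖c - (g a - g b)‖ ^ 2 := by
    rw [← real_inner_smul_left, ← real_inner_smul_right, hpc, real_inner_self_eq_norm_sq]
  have e3 : ‖c - (g a - g b)‖ ^ 2 = ‖c‖ ^ 2 - 2 * ⟪g a - g b, c⟫ + ‖g a - g b‖ ^ 2 := by
    rw [norm_sub_sq_real, real_inner_comm]
  have e4 : ‖c + p‖ ^ 2 = ‖c‖ ^ 2 + 2 * ⟪c, p⟫ + ⟪p, p⟫ := by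
    rw [norm_add_sq_real, real_inner_self_eq_norm_sq p]
  rw [inner_add_right, e4] at h2
  rw [← real_inner_self_eq_norm_sq p] at h1
  have h4 : 0 ≤ f a - f b - ⟪g b, c⟫ - 1 / 2 * ‖c‖ ^ 2 - (M - 1) / 2 * ⟪p, p⟫ := by linarith
  have h5 := mul_nonneg hM'.le h4
  nlinarith

/-- Per-sample inequality. -/
lemma sample_aux {d : ℕ} {M α β w P L1 L2 L4 L5 f0 fi fs : ℝ}
    (x G e u : EuclideanSpace ℝ (Fin d))
    (hw : 0 ≤ w) (hP : 0 ≤ P) (h1 : 0 ≤ L1) (h2 : 0 ≤ L2) (h3 : 0 ≤ L1 - L2)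
    (h4 : 0 ≤ L4) (h5 : 0 ≤ L5)
    (hx : L1 + M * L2 = β) (hxg : α - M * (L1 - L2) - α * M * (L1 + L2) = 0)
    (hT : w * P * (1 - w) = β ^ 2 - L1 - L2)
    (hs : L4 + L5 = w * P) (hd : L4 - L5 = L1 - L2)
    (hC : α * (M * L4 + L5) = w * P)
    (hA : w * P + (L1 - L2) - α ^ 2 + M * α ^ 2 * (L1 + L2) + M * α ^ 2 * (w * P)
      - 2 * α * (L4 + M * L5) = w * (w * P))
    (q1 : 0 ≤ 2 * (M - 1) * (fi - fs - ⟪(0 : EuclideanSpace ℝ (Fin d)), x - α • (G + e)⟫)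
      - ‖u - 0‖ ^ 2 - M * ‖x - α • (G + e)‖ ^ 2 + 2 * ⟪u - 0, x - α • (G + e)⟫)
    (q2 : 0 ≤ 2 * (M - 1) * (fs - fi - ⟪u, -(x - α • (G + e))⟫)
      - ‖0 - u‖ ^ 2 - M * ‖-(x - α • (G + e))‖ ^ 2 + 2 * ⟪0 - u, -(x - α • (G + e))⟫)
    (q3 : 0 ≤ 2 * (M - 1) * (fs - f0 - ⟪G, -x⟫)
      - ‖0 - G‖ ^ 2 - M * ‖-x‖ ^ 2 + 2 * ⟪0 - G, -x⟫)
    (q4 : 0 ≤ 2 * (M - 1) * (f0 - fi - ⟪u, α • (G + e)⟫)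
      - ‖G - u‖ ^ 2 - M * ‖α • (G + e)‖ ^ 2 + 2 * ⟪G - u, α • (G + e)⟫)
    (q5 : 0 ≤ 2 * (M - 1) * (fi - f0 - ⟪G, -(α • (G + e))⟫)
      - ‖u - G‖ ^ 2 - M * ‖-(α • (G + e))‖ ^ 2 + 2 * ⟪u - G, -(α • (G + e))⟫) :
    ‖x - α • (G + e) - β • u‖ ^ 2 ≤ (1 - M * ((L1 - L2) + L1 + L2)) * ‖x‖ ^ 2
      + ((1 - w ^ 2) * P + w * P - 2 * α * (L4 + M * L5) + (L1 - L2)) * ‖e‖ ^ 2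
      + (2 * α ^ 2 - 2 * M * α ^ 2 * (L1 + L2) - 2 * M * α ^ 2 * (w * P)
          + 2 * α * (L4 + M * L5)) * ⟪G, e⟫
      + (-2 * α + 2 * α * M * (L1 + L2)) * ⟪x, e⟫ := by
  have r1 := mul_nonneg h1 q1
  have r2 := mul_nonneg h2 q2
  have r3 := mul_nonneg h3 q3
  have r4 := mul_nonneg h4 q4
  have r5 := mul_nonneg h5 q5
  have r6 := mul_nonneg hP (sq_nonneg ‖e + w • u‖)
  have r7 := mul_nonneg (mul_nonneg hw (mul_nonneg hw hP)) (sq_nonneg ‖G‖)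
  simp only [← real_inner_self_eq_norm_sq, inner_sub_left, inner_sub_right, inner_add_left,
    inner_add_right, real_inner_smul_left, real_inner_smul_right, inner_neg_left,
    inner_neg_right, inner_zero_left, inner_zero_right, real_inner_comm x G,
    real_inner_comm x e, real_inner_comm x u, real_inner_comm G e, real_inner_comm G u,
    real_inner_comm e u] at r1 r2 r3 r4 r5 r6 r7 ⊢
  generalize ⟪x, x⟫ = xx at *
  generalize ⟪x, G⟫ = xg at *
  generalize ⟪x, e⟫ = xe at *
  generalize ⟪x, u⟫ = xu at *
  generalize ⟪G, G⟫ = gg at *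
  generalize ⟪G, e⟫ = ge at *
  generalize ⟪G, u⟫ = gu at *
  generalize ⟪e, e⟫ = ee at *
  generalize ⟪e, u⟫ = eu at *
  generalize ⟪u, u⟫ = uu at *
  clear q1 q2 q3 q4 q5 h1 h2 h3 h4 h5 hP hw
  linear_combination r1 + r2 + r3 + r4 + r5 + r6 + r7 - 2 * xg * hxg
    + 2 * (xu - α * gu - α * eu) * hx - uu * hT - (2 * gu + 2 * eu) * hC - (gg + ee) * hA
    + 2 * (M - 1) * (f0 - fi) * hd
    - (gg + uu - 2 * gu + M * α ^ 2 * (gg + ee + 2 * ge)) * hs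

/-- Scalar facts. -/
lemma scalar_aux {M w α β : ℝ} (hM : 1 < M) (hw : 0 < w) (hw1 : w ≤ (M - 1) / M)
    (hα0 : 1 / M ≤ α) (hα1 : α < 1) (hβ0 : α / M < β) (hβ1 : β < (M + 1) / (2 * M))
    (hh : (M - 1) * M * α ^ 3 - (M + 1) * (M - 2) * α ^ 2 - (4 + (M - 1) * w) * α + 2 = 0)
    (hq : M * ((M - 1) ^ 2 + (M + 1) ^ 2 * w) * ((M - 1) * α + (M + 1)) * β ^ 2
      + 2 * M * (2 * (M - 1) * M * (w - 1) * α ^ 2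
      + (M + 1) * (w - 1) * ((3 - M) + (M - 1) * w) * α
      + (1 - (M - 4) * M - (M + 1) * (M + 3) * w)) * β
      + (-2 * M * (M ^ 2 - 1) * (w - 1) * α ^ 2
      + (2 * (2 + M + 2 * M ^ 2 - M ^ 3) + (M - 3) * (M + 1) ^ 2 * w
          - (M - 1) * (M + 1) ^ 2 * w ^ 2) * α
      + 2 * (M + 1) ^ 2 * (w - 1)) = 0)
    {L1 L2 T : ℝ} (hL1 : L1 * (1 + M + (M - 1) * α) = α + β - α * β)
    (hL2 : M * L2 * (1 + M + (M - 1) * α) = M * β + α * (M * β - 1))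
    (hT : T * (1 - w) = β ^ 2 - L1 - L2) :
    0 ≤ L1 ∧ 0 ≤ L2 ∧ 0 ≤ L1 - L2 ∧ 0 ≤ T ∧ L1 - L2 ≤ T ∧
    L1 + M * L2 = β ∧ α - M * (L1 - L2) - α * M * (L1 + L2) = 0 ∧
    α * ((M + 1) * T + (M - 1) * (L1 - L2)) = 2 * T ∧
    T + (L1 - L2) - α ^ 2 + M * α ^ 2 * (L1 + L2) + M * α ^ 2 * T
      - α * ((M + 1) * T - (M - 1) * (L1 - L2)) = w * T := by
  have hM0 : 0 < M := by linarith
  rw [div_le_iff₀ hM0] at hα0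
  rw [div_lt_iff₀ hM0] at hβ0
  rw [lt_div_iff₀ (by linarith)] at hβ1
  rw [le_div_iff₀ hM0] at hw1
  have hα : 0 < α := by by_contra h; nlinarith
  have hβ : 0 < β := by by_contra h; nlinarith
  have hD : 0 < 1 + M + (M - 1) * α := by nlinarith
  have hw2 : 0 < 1 - w := by nlinarith
  have hx : L1 + M * L2 = β := by
    apply mul_right_cancel₀ hD.ne'; linear_combination hL1 + hL2
  have hxg : α - M * (L1 - L2) - α * M * (L1 + L2) = 0 := by
    apply mul_right_cancel₀ hD.ne'
    linear_combination (-M - α * M) * hL1 + (1 - α) * hL2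
  have hL3 : M * (L1 - L2) * (1 + M + (M - 1) * α) = α * (M + 1 - 2 * M * β) := by
    linear_combination M * hL1 - hL2
  have l1 : 0 < L1 := by
    have h1 : 0 < α + β - α * β := by
      have := mul_pos (sub_pos.2 hα1) hβ
      linarith
    rw [← hL1] at h1
    exact pos_of_mul_pos_left h1 hD.le
  have l2 : 0 < L2 := by
    have h1 : 0 < M * β + α * (M * β - 1) := by
      have := mul_pos hα (mul_pos hM0 hβ)
      linarith
    rw [← hL2] at h1
    exact pos_of_mul_pos_right (pos_of_mul_pos_left h1 hD.le) hM0.le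
  have l3 : 0 < L1 - L2 := by
    have h1 : 0 < α * (M + 1 - 2 * M * β) := mul_pos hα (by linarith)
    rw [← hL3] at h1
    exact pos_of_mul_pos_right (pos_of_mul_pos_left h1 hD.le) hM0.le
  -- the small root
  have hsm : 0 < 2 - (M + 1) * α := by
    have h1 : (1 - α) * (M * (M - 1) * α ^ 2 + 2 * α - 2) = - ((M - 1) * w * α) := by
      linear_combination -hh
    have h2 : M * (M - 1) * α ^ 2 + 2 * α - 2 < 0 := by
      by_contra h
      have h3 := mul_nonneg (sub_pos.2 hα1).le (not_lt.1 h)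
      have h4 : 0 < (M - 1) * w * α := by
        have := sub_pos.2 hM
        positivity
      linarith
    by_contra h
    have h3 : 2 ≤ (M + 1) * α := by linarith
    have h4 : 4 ≤ ((M + 1) * α) ^ 2 := by
      have := pow_le_pow_left₀ (by norm_num) h3 2
      linarith
    have h5 : 4 * (M * (M - 1)) ≤ ((M + 1) * α) ^ 2 * (M * (M - 1)) :=
      mul_le_mul_of_nonneg_right h4 (mul_nonneg hM0.le (by linarith))
    have h6 : (M + 1) * 2 ≤ (M + 1) * ((M + 1) * α) :=
      mul_le_mul_of_nonneg_left h3 (by linarith)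
    have h7 : (M + 1) ^ 2 * (M * (M - 1) * α ^ 2 + 2 * α - 2) < 0 :=
      mul_neg_of_pos_of_neg (by positivity) h2
    have h8 := sq_nonneg (M - 1)
    linarith
  have hK : 0 < (M - 1) ^ 2 + (M + 1) ^ 2 * w := by positivity
  -- the key equation
  have hE : (M * (1 + M + (M - 1) * α) * β ^ 2 - (M - 1) * α - 2 * M * β) * (2 - (M + 1) * α)
      = α * (M - 1) * (1 - w) * (α * (M + 1 - 2 * M * β)) := by
    apply mul_left_cancel₀ hK.ne'
    linear_combination (2 - (M + 1) * α) * hq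
      - 2 * (M + 1) * (1 - w) * (2 * M * β - (M + 1)) * hh
  have hCT : α * ((M + 1) * T + (M - 1) * (L1 - L2)) = 2 * T := by
    apply mul_left_cancel₀ (mul_pos (mul_pos hM0 hD) hw2).ne'
    linear_combination -hE - M * (1 + M + (M - 1) * α) * (2 - (M + 1) * α) * hT
      + α * (M - 1) * (1 - w) * hL3 + (2 - (M + 1) * α) * (M * hL1 + hL2)
  have hTpos : 0 < T := by
    have h1 : 0 < α * (M - 1) * (L1 - L2) := mul_pos (mul_pos hα (by linarith)) l3
    have h2 : 0 < T * (2 - (M + 1) * α) := by linarith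
    exact pos_of_mul_pos_left h2 hsm.le
  refine ⟨l1.le, l2.le, l3.le, hTpos.le, ?_, hx, hxg, hCT, ?_⟩
  · by_contra h
    have h1 : T * (2 - (M + 1) * α) < (L1 - L2) * (2 - (M + 1) * α) :=
      mul_lt_mul_of_pos_right (not_le.1 h) hsm
    have h2 : 0 ≤ (L1 - L2) * (2 * (α * M - 1)) := mul_nonneg l3.le (by linarith)
    linarith
  · apply mul_left_cancel₀ (mul_pos hα (sub_pos.2 hM)).ne'
    linear_combination T * hh + (1 - α) * hCT - α * (M - 1) * α * hxg

theorem stmt_16 (d : ℕ) (M R σ v : ℝ) (n : ℕ)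
    (hM : 1 < M) (hR : 0 < R) (hσ : 0 < σ) (hn : 2 ≤ n)
    (hv0 : 0 < v) (hv1 : v ≤ (M - 1) * (n : ℝ) / (((n : ℝ) - 1) * M))
    (α β : ℝ)
    (hα : α ∈ Set.Ico (1 / M) 1) (hroot : hcub M (n : ℝ) v α = 0)
    (hβ : β ∈ Set.Ioo (α / M) ((M + 1) / (2 * M))) (hqroot : qquad M (n : ℝ) v α β = 0)
    (f : EuclideanSpace ℝ (Fin d) → ℝ)
    (g : EuclideanSpace ℝ (Fin d) → EuclideanSpace ℝ (Fin d))
    (hgrad : ∀ x, HasGradientAt f (g x) x)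
    (hstrong : ∀ x y, f y ≥ f x + ⟪g x, y - x⟫ + 1 / 2 * ‖y - x‖ ^ 2)
    (hlip : ∀ x y, ‖g x - g y‖ ≤ M * ‖x - y‖)
    (xstar : EuclideanSpace ℝ (Fin d)) (hmin : ∀ y, f xstar ≤ f y)
    (x₀ : EuclideanSpace ℝ (Fin d)) (hx₀ : ‖x₀ - xstar‖ ≤ R)
    (g₀ : Fin n → EuclideanSpace ℝ (Fin d))
    (hg₀mean : (1 / (n : ℝ)) • ∑ i, g₀ i = g x₀)
    (hg₀var : 1 / (n : ℝ) * ∑ i, ‖g₀ i - g x₀‖ ^ 2 ≤ σ ^ 2)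
    (x₁ : Fin n → EuclideanSpace ℝ (Fin d))
    (hx₁ : ∀ i, x₁ i = x₀ - α • g₀ i)
    (g₁ : Fin n → Fin n → EuclideanSpace ℝ (Fin d))
    (hg₁mean : ∀ i, (1 / (n : ℝ)) • ∑ j, g₁ i j = g (x₁ i))
    (hg₁var : ∀ i, 1 / (n : ℝ) * ∑ j, ‖g₁ i j - g (x₁ i)‖ ^ 2 ≤ σ ^ 2)
    (x₂ : Fin n → Fin n → EuclideanSpace ℝ (Fin d))
    (hx₂ : ∀ i j, x₂ i j = x₁ i - β • g₁ i j) :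
    1 / (n : ℝ) ^ 2 * ∑ i, ∑ j, ‖x₂ i j - xstar‖ ^ 2
      ≤ tauD M (n : ℝ) α β * R ^ 2
        + (mu0 M (n : ℝ) v α β + (n : ℝ) * mu1 M (n : ℝ) v α β) * σ ^ 2 := by
  have hN2 : (2 : ℝ) ≤ (n : ℝ) := by exact_mod_cast hn
  set N : ℝ := (n : ℝ) with hN
  have hN0 : 0 < N := by linarith
  have hN1 : 0 < N - 1 := by linarith
  have hM0 : 0 < M := by linarith
  obtain ⟨hα0, hα1⟩ := hα
  obtain ⟨hβ0, hβ1⟩ := hβ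
  have hα : 0 < α := lt_of_lt_of_le (by positivity) hα0
  have hD : 0 < 1 + M + (M - 1) * α := by
    have := mul_pos (sub_pos.2 hM) hα
    linarith
  obtain ⟨w, hw⟩ : ∃ w, w = (N - 1) * v / N := ⟨_, rfl⟩
  have hwN : (N - 1) * v = w * N := by rw [hw]; field_simp
  have hw0 : 0 < w := by rw [hw]; positivity
  have hw1 : w ≤ (M - 1) / M := by
    rw [le_div_iff₀ (by positivity)] at hv1
    rw [le_div_iff₀ hM0]
    have h1 : (w * M) * N ≤ (M - 1) * N := by
      calc (w * M) * N = v * ((N - 1) * M) := by linear_combination -M * hwN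
        _ ≤ _ := hv1
    exact le_of_mul_le_mul_right h1 hN0
  have hw2 : 0 < 1 - w := by
    have : (M - 1) / M < 1 := by rw [div_lt_one hM0]; linarith
    linarith
  obtain ⟨L1, hL1⟩ : ∃ L, L = N * lam1 M N α β := ⟨_, rfl⟩
  obtain ⟨L2, hL2⟩ : ∃ L, L = N * lam2 M N α β := ⟨_, rfl⟩
  obtain ⟨T, hT⟩ : ∃ T, T = (β ^ 2 - L1 - L2) / (1 - w) := ⟨_, rfl⟩
  have hL1' : L1 * (1 + M + (M - 1) * α) = α + β - α * β := by
    have hD' := hD.ne'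
    rw [hL1, lam1, ← mul_div_assoc, mul_div_mul_left _ _ hN0.ne', div_mul_cancel₀ _ hD']
  have hL2' : M * L2 * (1 + M + (M - 1) * α) = M * β + α * (M * β - 1) := by
    have hD' := hD.ne'
    rw [hL2, lam2, ← mul_assoc, ← mul_div_assoc, mul_div_mul_left _ _ (mul_pos hM0 hN0).ne',
      div_mul_cancel₀ _ hD']
  have hT' : T * (1 - w) = β ^ 2 - L1 - L2 := by
    rw [hT]; field_simp
  have hh : (M - 1) * M * α ^ 3 - (M + 1) * (M - 2) * α ^ 2 - (4 + (M - 1) * w) * α + 2 = 0 := by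
    apply mul_left_cancel₀ hN0.ne'
    rw [hcub] at hroot
    linear_combination hroot + (M - 1) * α * hwN
  have hq : M * ((M - 1) ^ 2 + (M + 1) ^ 2 * w) * ((M - 1) * α + (M + 1)) * β ^ 2
      + 2 * M * (2 * (M - 1) * M * (w - 1) * α ^ 2
      + (M + 1) * (w - 1) * ((3 - M) + (M - 1) * w) * α
      + (1 - (M - 4) * M - (M + 1) * (M + 3) * w)) * β
      + (-2 * M * (M ^ 2 - 1) * (w - 1) * α ^ 2
      + (2 * (2 + M + 2 * M ^ 2 - M ^ 3) + (M - 3) * (M + 1) ^ 2 * w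
          - (M - 1) * (M + 1) ^ 2 * w ^ 2) * α
      + 2 * (M + 1) ^ 2 * (w - 1)) = 0 := by
    apply mul_left_cancel₀ (pow_pos hN0 2).ne'
    have hv : v = w * N / (N - 1) := by rw [← hwN]; field_simp
    have hNe : N - 1 ≠ 0 := hN1.ne'
    rw [qquad, hv] at hqroot
    rw [mul_zero, ← hqroot]
    field_simp
  obtain ⟨l1, l2, l3, l4, l5, hx, hxg, hCT, hA⟩ :=
    scalar_aux hM hw0 hw1 hα0 hα1 hβ0 hβ1 hh hq hL1' hL2' hT'
  have hk : N - (N - 1) * v = N * (1 - w) := by rw [hwN]; ring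
  have e1 : lam1 M N α β = L1 / N := by rw [hL1]; field_simp
  have e2 : lam2 M N α β = L2 / N := by rw [hL2]; field_simp
  have hTN : (N ^ 2 * (L1 / N + M * (L2 / N)) ^ 2 - N * (L1 / N + L2 / N))
      / (2 * (N * (1 - w))) = T / (2 * N) := by
    rw [hT, ← hx]
    field_simp
    ring
  have e4 : lam4 M N v α β = ((T + (L1 - L2)) / 2) / N := by
    rw [lam4, e1, e2, hk, hTN]; field_simp
  have e5 : lam5 M N v α β = ((T - (L1 - L2)) / 2) / N := by
    rw [lam5, e1, e2, hk, hTN]; field_simp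
  have e3 : lam3 M N α β = L1 - L2 := by
    rw [lam3, e1, e2]; field_simp
  have eτ : tauD M N α β = 1 - M * ((L1 - L2) + L1 + L2) := by
    rw [tauD, e1, e2, e3]; field_simp
  have eμ1 : N * mu1 M N v α β = β ^ 2 := by
    have : (1 - (N - 1) * v / N) * (lam4 M N v α β + lam5 M N v α β)
      + lam2 M N α β + lam1 M N α β = β ^ 2 / N := by
      rw [e4, e5, e1, e2, ← hw]
      field_simp
      linear_combination 2 * hT'
    rw [mu1, this, max_eq_right (by positivity)]
    field_simp
  obtain ⟨P, hP⟩ : ∃ P, P = T / w := ⟨_, rfl⟩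
  have hwP : T = w * P := by rw [hP]; field_simp
  have hP0 : 0 ≤ P := by rw [hP]; positivity
  obtain ⟨m, hm⟩ : ∃ m, m = (1 - w ^ 2) * P + w * P
    - 2 * α * ((T + (L1 - L2)) / 2 + M * ((T - (L1 - L2)) / 2)) + (L1 - L2) := ⟨_, rfl⟩
  have em : mu0 M N v α β = max 0 m := by
    rw [mu0, hm, e4, e5, e3, hP, hwN]
    have : (N - 1) ^ 2 * v ^ 2 = (w * N) ^ 2 := by rw [← hwN]; ring
    rw [this]
    congr 1
    field_simp
    ring
  have hgs : g xstar = 0 := by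
    have h1 : IsLocalMin f xstar := Filter.Eventually.of_forall hmin
    have h2 := h1.hasFDerivAt_eq_zero (hgrad xstar).hasFDerivAt
    simpa using h2
  -- per-sample inequality
  have hsample : ∀ i, ‖x₁ i - xstar - β • g (x₁ i)‖ ^ 2
      ≤ (1 - M * ((L1 - L2) + L1 + L2)) * ‖x₀ - xstar‖ ^ 2 + m * ‖g₀ i - g x₀‖ ^ 2
      + (2 * α ^ 2 - 2 * M * α ^ 2 * (L1 + L2) - 2 * M * α ^ 2 * (w * P)
          + 2 * α * ((T + (L1 - L2)) / 2 + M * ((T - (L1 - L2)) / 2))) * ⟪g x₀, g₀ i - g x₀⟫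
      + (-2 * α + 2 * α * M * (L1 + L2)) * ⟪x₀ - xstar, g₀ i - g x₀⟫ := by
    intro i
    have hc : x₁ i - xstar = (x₀ - xstar) - α • (g x₀ + (g₀ i - g x₀)) := by
      rw [hx₁, add_sub_cancel]; abel
    have hc2 : x₀ - x₁ i = α • (g x₀ + (g₀ i - g x₀)) := by
      rw [hx₁, add_sub_cancel]; abel
    have I := interp_aux hM hgrad hstrong hlip
    rw [hc, hm]
    refine sample_aux (f0 := f x₀) (fi := f (x₁ i)) (fs := f xstar) _ _ _ _ hw0.le hP0 l1 l2 l3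
      (by linarith) (by linarith) hx hxg ?_ ?_ ?_ ?_ ?_ ?_ ?_ ?_ ?_ ?_
    · rw [← hwP]; exact hT'
    · rw [← hwP]; ring
    · ring
    · rw [← hwP]; linear_combination hCT / 2
    · rw [← hwP]; linear_combination hA
    · exact I _ _ _ _ _ rfl hgs hc
    · exact I _ _ _ _ _ hgs rfl (by rw [← hc]; abel)
    · exact I _ _ _ _ _ hgs rfl (by abel)
    · exact I _ _ _ _ _ rfl rfl hc2
    · exact I _ _ _ _ _ rfl rfl (by rw [← hc2]; abel)
  have hsum0 : ∑ i, (g₀ i - g x₀) = 0 := by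
    rw [Finset.sum_sub_distrib, ← hg₀mean]
    simp [← hN, ← Nat.cast_smul_eq_nsmul ℝ, smul_smul, hN0.ne']
  have hsum : ∑ i, ‖x₁ i - xstar - β • g (x₁ i)‖ ^ 2
      ≤ N * ((1 - M * ((L1 - L2) + L1 + L2)) * ‖x₀ - xstar‖ ^ 2)
        + m * ∑ i, ‖g₀ i - g x₀‖ ^ 2 := by
    refine (Finset.sum_le_sum fun i _ => hsample i).trans ?_
    rw [Finset.sum_add_distrib, Finset.sum_add_distrib, Finset.sum_add_distrib,
      ← Finset.mul_sum, ← Finset.mul_sum, ← Finset.mul_sum, ← Finset.mul_sum, ← inner_sum,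
      ← inner_sum, hsum0]
    simp only [Finset.sum_const, Finset.card_univ, Fintype.card_fin, nsmul_eq_mul, ← hN,
      inner_zero_right, mul_zero, add_zero]
    apply le_of_eq
    ring
  -- inner variance decomposition
  have hinner : ∀ i, ∑ j, ‖x₂ i j - xstar‖ ^ 2
      ≤ N * ‖x₁ i - xstar - β • g (x₁ i)‖ ^ 2 + N * (β ^ 2 * σ ^ 2) := by
    intro i
    have hs0 : ∑ j, (g₁ i j - g (x₁ i)) = 0 := by
      rw [Finset.sum_sub_distrib, ← hg₁mean i]
      simp [← hN, ← Nat.cast_smul_eq_nsmul ℝ, smul_smul, hN0.ne']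
    have hj : ∀ j, ‖x₂ i j - xstar‖ ^ 2 = ‖x₁ i - xstar - β • g (x₁ i)‖ ^ 2
        - 2 * β * ⟪x₁ i - xstar - β • g (x₁ i), g₁ i j - g (x₁ i)⟫
        + β ^ 2 * ‖g₁ i j - g (x₁ i)‖ ^ 2 := by
      intro j
      have : x₂ i j - xstar = (x₁ i - xstar - β • g (x₁ i)) - β • (g₁ i j - g (x₁ i)) := by
        rw [hx₂, smul_sub]; abel
      rw [this, norm_sub_sq_real, real_inner_smul_right, norm_smul, mul_pow, Real.norm_eq_abs,
        sq_abs]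
      ring
    have hvar := hg₁var i
    rw [one_div, inv_mul_le_iff₀ hN0] at hvar
    have h1 := mul_le_mul_of_nonneg_left hvar (sq_nonneg β)
    rw [Finset.sum_congr rfl fun j _ => hj j, Finset.sum_add_distrib, Finset.sum_sub_distrib,
      ← Finset.mul_sum, ← Finset.mul_sum, ← inner_sum, hs0]
    simp only [Finset.sum_const, Finset.card_univ, Fintype.card_fin, nsmul_eq_mul, ← hN,
      inner_zero_right, mul_zero, sub_zero]
    linarith
  have hτ : 0 ≤ 1 - M * ((L1 - L2) + L1 + L2) := by
    rw [lt_div_iff₀ (by linarith)] at hβ1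
    have h1 : 0 < (M + 1 - β * (2 * M)) * (1 - α) :=
      mul_pos (sub_pos.2 hβ1) (sub_pos.2 hα1)
    have h2 : (1 - M * ((L1 - L2) + L1 + L2)) * (1 + M + (M - 1) * α)
        = (M + 1 - β * (2 * M)) * (1 - α) := by
      linear_combination -2 * M * hL1'
    rw [← h2] at h1
    exact (pos_of_mul_pos_left h1 hD.le).le
  have hv0' : ∑ i, ‖g₀ i - g x₀‖ ^ 2 ≤ N * σ ^ 2 := by
    rwa [one_div, inv_mul_le_iff₀ hN0] at hg₀var
  have hfin : ∑ i, ∑ j, ‖x₂ i j - xstar‖ ^ 2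
      ≤ N * ∑ i, ‖x₁ i - xstar - β • g (x₁ i)‖ ^ 2 + N * (N * (β ^ 2 * σ ^ 2)) := by
    refine (Finset.sum_le_sum fun i _ => hinner i).trans ?_
    rw [Finset.sum_add_distrib, ← Finset.mul_sum]
    simp [← hN]
  rw [eτ, em, eμ1, one_div, inv_mul_le_iff₀ (by positivity)]
  have hR2 : ‖x₀ - xstar‖ ^ 2 ≤ R ^ 2 := pow_le_pow_left₀ (norm_nonneg _) hx₀ 2
  have k1 := mul_le_mul_of_nonneg_left hR2 hτ
  have hS : 0 ≤ ∑ i, ‖g₀ i - g x₀‖ ^ 2 := Finset.sum_nonneg fun i _ => sq_nonneg _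
  have k2 : m * ∑ i, ‖g₀ i - g x₀‖ ^ 2 ≤ max 0 m * (N * σ ^ 2) :=
    (mul_le_mul_of_nonneg_right (le_max_right 0 m) hS).trans
      (mul_le_mul_of_nonneg_left hv0' (le_max_left 0 m))
  have k3 := mul_le_mul_of_nonneg_left k1 hN0.le
  have k4 : ∑ i, ‖x₁ i - xstar - β • g (x₁ i)‖ ^ 2
      ≤ N * ((1 - M * ((L1 - L2) + L1 + L2)) * R ^ 2) + max 0 m * (N * σ ^ 2) := by linarith
  have k5 := mul_le_mul_of_nonneg_left k4 hN0.le
  calc _ ≤ _ := hfin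
    _ ≤ N * (N * ((1 - M * ((L1 - L2) + L1 + L2)) * R ^ 2) + max 0 m * (N * σ ^ 2))
        + N * (N * (β ^ 2 * σ ^ 2)) := by linarith
    _ = _ := by ring
end

section
/- For every real M > 1, the constant 𝒞 := 1/2 + (1/2)·((M+1)⁴(√(2M² − 2M + 1) − M)²)/((M−1)⁴(2 + √(2M² − 2M + 1) − M)²) satisfies 𝒞 < 1; equivalently, (M+1)⁴·(√(2M² − 2M + 1) − M)² < (M−1)⁴·(2 + √(2M² − 2M + 1) − M)². -/
theorem stmt_17 (M : ℝ) (hM : 1 < M) :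
    (1 / 2 + 1 / 2 *
        ((M + 1) ^ 4 * (Real.sqrt (2 * M ^ 2 - 2 * M + 1) - M) ^ 2)
          / ((M - 1) ^ 4 * (2 + Real.sqrt (2 * M ^ 2 - 2 * M + 1) - M) ^ 2)) < 1 ∧
    (M + 1) ^ 4 * (Real.sqrt (2 * M ^ 2 - 2 * M + 1) - M) ^ 2
      < (M - 1) ^ 4 * (2 + Real.sqrt (2 * M ^ 2 - 2 * M + 1) - M) ^ 2 := by
  have hs2 : Real.sqrt (2 * M ^ 2 - 2 * M + 1) ^ 2 = 2 * M ^ 2 - 2 * M + 1 :=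
    Real.sq_sqrt (by nlinarith)
  have hsM : M < Real.sqrt (2 * M ^ 2 - 2 * M + 1) :=
    Real.lt_sqrt_of_sq_lt (by nlinarith [mul_pos (sub_pos.2 hM) (sub_pos.2 hM)])
  generalize Real.sqrt (2 * M ^ 2 - 2 * M + 1) = s at *
  have h0 : 0 < s - M := sub_pos.2 hsM
  have h1 : 0 < M - 1 := sub_pos.2 hM
  have key : (M + 1) ^ 2 * (s - M) < (M - 1) ^ 2 * (2 + s - M) := by
    have : (M - 1) ^ 2 * (2 + s - M) - (M + 1) ^ 2 * (s - M) = 2 * (s - M) ^ 2 := by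
      linear_combination (-2) * hs2
    have h2 : 0 < (s - M) ^ 2 := by positivity
    linarith
  have main : (M + 1) ^ 4 * (s - M) ^ 2 < (M - 1) ^ 4 * (2 + s - M) ^ 2 := by
    have h3 : 0 ≤ (M + 1) ^ 2 * (s - M) := by positivity
    have := pow_lt_pow_left₀ key h3 (n := 2) (by norm_num)
    calc _ = ((M + 1) ^ 2 * (s - M)) ^ 2 := by ring
      _ < _ := this
      _ = _ := by ring
  refine ⟨?_, main⟩
  have hpos : 0 < (M - 1) ^ 4 * (2 + s - M) ^ 2 := lt_of_le_of_lt (by positivity) main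
  have : 1 / 2 * ((M + 1) ^ 4 * (s - M) ^ 2) / ((M - 1) ^ 4 * (2 + s - M) ^ 2) < 1 / 2 := by
    rw [div_lt_iff₀ hpos]
    linarith
  linarith
end
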